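/- arXiv:1307.2527 — 2 statements merged into one kernel-verified Lean document; each statement's English description precedes it below -/
import Mathlib

section
/- Let G be a finite group. Consider the square matrix over ℚ whose rows and columns are indexed by the conjugacy classes of subgroups of G, and whose (P,Q)-entry is the number |P\G/Q| of (P,Q)-double cosets in G. Then the rank of this matrix equals the number of conjugacy classes of cyclic subgroups of G. -/
/-- The set of double cosets `P\G/Q`, i.e. the set of orbits of the action of
`P × Q` on `G` given by `(p, q) · g = p * g * q⁻¹`. -/
def DoubleCosets {G : Type*} [Group G] (P Q : Subgroup G) : Type _ :=
  Quot (fun x y : G => ∃ p ∈ P, ∃ q ∈ Q, p * x * q⁻¹ = y)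

theorem rank_smul_aux {ι : Type} [Fintype ι] [DecidableEq ι] (c : ℚ) (M : Matrix ι ι ℚ)
    (hc : c ≠ 0) : (c • M).rank = M.rank := by
  apply le_antisymm
  · rw [← Matrix.one_mul M, ← Matrix.smul_mul]
    exact (Matrix.rank_mul_le_right _ _).trans (by rw [Matrix.one_mul])
  · have : M = (c⁻¹ • (1 : Matrix ι ι ℚ)) * (c • M) := by
      rw [Matrix.smul_mul, Matrix.one_mul, smul_smul, inv_mul_cancel₀ hc, one_smul]
    conv_lhs => rw [this]
    exact Matrix.rank_mul_le_right _ _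

/-- The number of `x` with `D ≤ x P x⁻¹`. -/
noncomputable def markCount {G : Type*} [Group G] (P D : Subgroup G) : ℕ :=
  Nat.card {x : G // D ≤ Subgroup.map (MulAut.conj x).toMonoidHom P}

theorem map_conj_map_conj {G : Type*} [Group G] (a b : G) (P : Subgroup G) :
    Subgroup.map (MulAut.conj a).toMonoidHom (Subgroup.map (MulAut.conj b).toMonoidHom P)
      = Subgroup.map (MulAut.conj (a * b)).toMonoidHom P := by
  rw [Subgroup.map_map]
  congr 1
  ext x
  simp [mul_assoc]

theorem map_conj_one {G : Type*} [Group G] (P : Subgroup G) :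
    Subgroup.map (MulAut.conj (1 : G)).toMonoidHom P = P := by
  ext x
  simp [Subgroup.mem_map]

theorem mem_map_conj {G : Type*} [Group G] (a x : G) (P : Subgroup G) :
    x ∈ Subgroup.map (MulAut.conj a).toMonoidHom P ↔ a⁻¹ * x * a ∈ P := by
  constructor
  · rintro ⟨y, hy, rfl⟩
    have : y ∈ P := hy
    simpa [mul_assoc] using this
  · intro h
    exact ⟨_, h, by simp [mul_assoc]⟩

theorem map_conj_le {G : Type*} [Group G] (a : G) (D P : Subgroup G) :
    Subgroup.map (MulAut.conj a).toMonoidHom D ≤ P ↔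
      D ≤ Subgroup.map (MulAut.conj a⁻¹).toMonoidHom P := by
  constructor
  · intro h
    have := Subgroup.map_mono (f := (MulAut.conj a⁻¹).toMonoidHom) h
    rwa [map_conj_map_conj, inv_mul_cancel, map_conj_one] at this
  · intro h
    have := Subgroup.map_mono (f := (MulAut.conj a).toMonoidHom) h
    rwa [map_conj_map_conj, mul_inv_cancel, map_conj_one] at this

theorem card_map_conj {G : Type*} [Group G] (a : G) (P : Subgroup G) :
    Nat.card (Subgroup.map (MulAut.conj a).toMonoidHom P) = Nat.card P :=
  Subgroup.card_map_of_injective (MulAut.conj a).injective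

theorem markCount_conj {G : Type*} [Group G] (P D : Subgroup G) (g : G) :
    markCount P (Subgroup.map (MulAut.conj g).toMonoidHom D) = markCount P D := by
  unfold markCount
  refine Nat.card_congr ((Equiv.mulLeft g⁻¹).subtypeEquiv ?_)
  intro x
  rw [map_conj_le, map_conj_map_conj]
  rfl

/-- The action of `P × Q` on `G`. -/
abbrev dcAction {G : Type*} [Group G] (P Q : Subgroup G) : MulAction (P × Q) G where
  smul m x := (m.1 : G) * x * (m.2 : G)⁻¹
  one_smul x := by
    change ((1 : P) : G) * x * ((1 : Q) : G)⁻¹ = x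
    simp
  mul_smul a b x := by
    change ((a.1 * b.1 : P) : G) * x * ((a.2 * b.2 : Q) : G)⁻¹
      = (a.1 : G) * ((b.1 : G) * x * (b.2 : G)⁻¹) * (a.2 : G)⁻¹
    simp [mul_assoc]

theorem card_dc_mul {G : Type*} [Group G] (P Q : Subgroup G) :
    Nat.card (Σ m : P × Q, {x : G // (m.1 : G) * x * (m.2 : G)⁻¹ = x})
      = Nat.card (DoubleCosets P Q) * (Nat.card P * Nat.card Q) := by
  letI := dcAction P Q
  have e := MulAction.sigmaFixedByEquivOrbitsProdGroup (P × Q) G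
  have h1 : Nat.card (Σ m : P × Q, {x : G // (m.1 : G) * x * (m.2 : G)⁻¹ = x})
      = Nat.card (Σ m : P × Q, MulAction.fixedBy G m) := rfl
  rw [h1, Nat.card_congr e, Nat.card_prod, Nat.card_prod]
  congr 1
  refine Nat.card_congr (Quot.congr (Equiv.refl G) ?_)
  intro x y
  constructor
  · intro h
    have h' : (MulAction.orbitRel (P × Q) G) y x := Setoid.symm' _ h
    obtain ⟨m, hm⟩ := h'
    exact ⟨m.1, m.1.2, m.2, m.2.2, hm⟩
  · rintro ⟨p, hp, q, hq, h⟩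
    have h' : (MulAction.orbitRel (P × Q) G) y x := ⟨(⟨p, hp⟩, ⟨q, hq⟩), h⟩
    exact Setoid.symm' _ h'

theorem tripleExt {G : Type*} [Group G] (P Q : Subgroup G)
    (s t : Σ g : G, {x : G // x⁻¹ * g * x ∈ P} × {y : G // y⁻¹ * g * y ∈ Q})
    (h1 : s.1 = t.1) (h2 : s.2.1.1 = t.2.1.1) (h3 : s.2.2.1 = t.2.2.1) : s = t := by
  obtain ⟨g, ⟨x, hx⟩, ⟨y, hy⟩⟩ := s
  obtain ⟨g', ⟨x', hx'⟩, ⟨y', hy'⟩⟩ := t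
  dsimp only at h1 h2 h3
  subst h1 h2 h3
  rfl

theorem fixExt {G : Type*} [Group G] (P Q : Subgroup G)
    (s t : Σ m : P × Q, {x : G // (m.1 : G) * x * (m.2 : G)⁻¹ = x})
    (h1 : (s.1.1 : G) = t.1.1) (h2 : (s.1.2 : G) = t.1.2) (h3 : s.2.1 = t.2.1) : s = t := by
  obtain ⟨⟨⟨p, hp⟩, ⟨q, hq⟩⟩, ⟨z, hz⟩⟩ := s
  obtain ⟨⟨⟨p', hp'⟩, ⟨q', hq'⟩⟩, ⟨z', hz'⟩⟩ := t
  dsimp only at h1 h2 h3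
  subst h1 h2 h3
  rfl

/-- Reparametrisation of triples. -/
def tripleEquiv {G : Type*} [Group G] (P Q : Subgroup G) :
    (Σ g : G, {x : G // x⁻¹ * g * x ∈ P} × {y : G // y⁻¹ * g * y ∈ Q}) ≃
      G × (Σ m : P × Q, {x : G // (m.1 : G) * x * (m.2 : G)⁻¹ = x}) where
  toFun t := (t.2.1.1, ⟨(⟨_, t.2.1.2⟩, ⟨_, t.2.2.2⟩), ⟨t.2.1.1⁻¹ * t.2.2.1, by
    simp [mul_assoc]⟩⟩)
  invFun s := ⟨s.1 * s.2.1.1 * s.1⁻¹, ⟨s.1, by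
      have := s.2.1.1.2
      simp [mul_assoc]⟩, ⟨s.1 * s.2.2.1, by
      have h := s.2.2.2
      have h2 : (s.2.1.1 : G) * s.2.2.1 = s.2.2.1 * s.2.1.2 := mul_inv_eq_iff_eq_mul.mp h
      have h3 : (s.1 * s.2.2.1)⁻¹ * (s.1 * s.2.1.1 * s.1⁻¹) * (s.1 * s.2.2.1)
          = s.2.1.2 := by
        have : (s.1 * s.2.2.1)⁻¹ * (s.1 * s.2.1.1 * s.1⁻¹) * (s.1 * s.2.2.1)
          = (s.2.2.1 : G)⁻¹ * (s.2.1.1 * s.2.2.1) := by group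
        rw [this, h2]
        group
      rw [h3]
      exact s.2.1.2.2⟩⟩
  left_inv := by
    rintro ⟨g, ⟨x, hx⟩, ⟨y, hy⟩⟩
    have h1 : x * (x⁻¹ * g * x) * x⁻¹ = g := by group
    have h2 : x * (x⁻¹ * y) = y := by group
    exact tripleExt P Q _ _ h1 rfl h2
  right_inv := by
    rintro ⟨x, ⟨⟨⟨p, hp⟩, ⟨q, hq⟩⟩, ⟨z, hz⟩⟩⟩
    dsimp only at hz
    have h2 : p * z = z * q := mul_inv_eq_iff_eq_mul.mp hz
    have h1 : x⁻¹ * (x * p * x⁻¹) * x = p := by group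
    have h3 : x⁻¹ * (x * z) = z := by group
    have h4 : (x * z)⁻¹ * (x * p * x⁻¹) * (x * z) = q := by
      have : (x * z)⁻¹ * (x * p * x⁻¹) * (x * z) = z⁻¹ * (p * z) := by group
      rw [this, h2]
      group
    exact Prod.ext rfl (fixExt P Q _ _ h1 h4 h3)

theorem markCount_zpowers {G : Type*} [Group G] (P : Subgroup G) (g : G) :
    markCount P (Subgroup.zpowers g) = Nat.card {x : G // x⁻¹ * g * x ∈ P} := by
  unfold markCount
  refine Nat.card_congr (Equiv.subtypeEquivRight ?_)
  intro x
  rw [Subgroup.zpowers_le, mem_map_conj]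

theorem sum_markCount {G : Type*} [Group G] [Fintype G] (P Q : Subgroup G) :
    ∑ g : G, markCount P (Subgroup.zpowers g) * markCount Q (Subgroup.zpowers g)
      = Nat.card G * (Nat.card (DoubleCosets P Q) * (Nat.card P * Nat.card Q)) := by
  rw [← card_dc_mul, ← Nat.card_prod, ← Nat.card_congr (tripleEquiv P Q), Nat.card_sigma]
  simp only [markCount_zpowers, Nat.card_prod]

/-- Conjugacy classes of cyclic subgroups. -/
abbrev CycClass (G : Type*) [Group G] : Type _ :=
  Quot (fun P Q : {P : Subgroup G // IsCyclic ↥P} =>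
          ∃ g : G, Subgroup.map (MulAut.conj g).toMonoidHom (P : Subgroup G)
            = (Q : Subgroup G))

/-- The column attached to a class of cyclic subgroups. -/
noncomputable def cycCol {G : Type*} [Group G] {ι : Type} (f : ι → Subgroup G)
    (C : CycClass G) : ι → ℚ := fun i =>
  Quot.lift (fun D : {P : Subgroup G // IsCyclic ↥P} =>
    (markCount (f i) D.1 : ℚ) / Nat.card (f i)) (by
      rintro D E ⟨g, hg⟩
      simp only [← hg, markCount_conj]) C

theorem cycCol_linearIndependent {G : Type*} [Group G] [Fintype G]
    {ι : Type} (f : ι → Subgroup G)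
    (hrep : ∀ P : Subgroup G, ∃ i, ∃ g : G, Subgroup.map (MulAut.conj g).toMonoidHom P = f i) :
    LinearIndependent ℚ (cycCol (G := G) f) := by
  classical
  haveI : Fintype (CycClass G) := Fintype.ofFinite _
  rw [Fintype.linearIndependent_iff]
  intro a ha
  have key : ∀ n : ℕ, ∀ C : {P : Subgroup G // IsCyclic ↥P}, Nat.card C.1 = n →
      a (Quot.mk _ C) = 0 := by
    intro n
    induction n using Nat.strong_induction_on with
    | _ n ih =>
      intro C hC
      obtain ⟨i, g, hg⟩ := hrep C.1
      have h := congrFun ha i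
      rw [Finset.sum_apply, Finset.sum_eq_single (Quot.mk _ C)] at h
      · have hpos : 0 < markCount (f i) C.1 := by
          unfold markCount
          have : Nonempty {x : G // C.1 ≤ Subgroup.map (MulAut.conj x).toMonoidHom (f i)} := by
            refine ⟨g⁻¹, ?_⟩
            rw [← hg, map_conj_map_conj, inv_mul_cancel, map_conj_one]
          exact Nat.card_pos
        have hpos2 : 0 < Nat.card (f i) := Nat.card_pos
        have hne : cycCol f (Quot.mk _ C) i ≠ 0 := by
          change (markCount (f i) C.1 : ℚ) / Nat.card (f i) ≠ 0
          positivity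
        exact (mul_eq_zero.mp h).resolve_right hne
      · intro D' _ hne
        induction D' using Quot.ind with
        | _ D =>
        by_cases hm : markCount (f i) D.1 = 0
        · have : cycCol f (Quot.mk _ D) i = 0 := by
            change (markCount (f i) D.1 : ℚ) / Nat.card (f i) = 0
            simp [hm]
          rw [Pi.smul_apply, this, smul_zero]
        · have hex : ∃ x : G, D.1 ≤ Subgroup.map (MulAut.conj x).toMonoidHom (f i) := by
            by_contra hcon
            push Not at hcon
            apply hm
            unfold markCount
            haveI : IsEmpty {x : G // D.1 ≤ Subgroup.map (MulAut.conj x).toMonoidHom (f i)} :=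
              ⟨fun x => hcon x.1 x.2⟩
            exact Nat.card_of_isEmpty
          obtain ⟨x, hx⟩ := hex
          rw [← hg, map_conj_map_conj] at hx
          have hle := Subgroup.card_le_of_le hx
          rw [card_map_conj, hC] at hle
          rcases hle.lt_or_eq with hlt | heq
          · rw [ih _ hlt D rfl, zero_smul, Pi.zero_apply]
          · exfalso
            apply hne
            symm
            apply Quot.sound
            refine ⟨x * g, ?_⟩
            symm
            apply Subgroup.eq_of_le_of_card_ge hx
            rw [card_map_conj, hC, heq]
      · exact fun hn => absurd (Finset.mem_univ _) hn
  intro C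
  induction C using Quot.ind with
  | _ C => exact key _ C rfl

/-- **Counting conjugacy classes of cyclic subgroups (Th\'evenaz).**
Let `G` be a finite group and let `f i`, for `i` in a finite index type `ι`, be a
system of representatives of the conjugacy classes of subgroups of `G`.  Then the
rank of the matrix `(|P\G/Q|)_{P,Q}` over `ℚ` equals the number of conjugacy
classes of cyclic subgroups of `G`. -/
theorem rank_doubleCoset_matrix_eq_card_cyclic_classes
    {G : Type*} [Group G] [Fintype G]
    {ι : Type} [Fintype ι] [DecidableEq ι] (f : ι → Subgroup G)
    (hrep : ∀ P : Subgroup G,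
      ∃! i, ∃ g : G, Subgroup.map (MulAut.conj g).toMonoidHom P = f i) :
    (Matrix.of fun i j : ι => (Nat.card (DoubleCosets (f i) (f j)) : ℚ)).rank
      = Nat.card (Quot (fun P Q : {P : Subgroup G // IsCyclic ↥P} =>
          ∃ g : G, Subgroup.map (MulAut.conj g).toMonoidHom (P : Subgroup G)
            = (Q : Subgroup G))) := by
  classical
  haveI : Fintype (CycClass G) := Fintype.ofFinite _
  let A : Matrix ι G ℚ := Matrix.of fun i g =>
    (markCount (f i) (Subgroup.zpowers g) : ℚ) / Nat.card (f i)
  have hG : (Nat.card G : ℚ) ≠ 0 := by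
    have : 0 < Nat.card G := Nat.card_pos
    positivity
  have hM : (Matrix.of fun i j : ι => (Nat.card (DoubleCosets (f i) (f j)) : ℚ))
      = ((Nat.card G : ℚ)⁻¹ • A) * A.transpose := by
    ext i j
    have h := congrArg (Nat.cast : ℕ → ℚ) (sum_markCount (f i) (f j))
    push_cast at h
    have hi : (Nat.card (f i) : ℚ) ≠ 0 := by
      have : 0 < Nat.card (f i) := Nat.card_pos
      positivity
    have hj : (Nat.card (f j) : ℚ) ≠ 0 := by
      have : 0 < Nat.card (f j) := Nat.card_pos
      positivity
    rw [Matrix.smul_mul, Matrix.smul_apply, Matrix.mul_apply]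
    simp only [A, Matrix.of_apply, Matrix.transpose_apply, div_mul_div_comm, smul_eq_mul]
    rw [← Finset.sum_div, h]
    field_simp
  have hrank : (Matrix.of fun i j : ι => (Nat.card (DoubleCosets (f i) (f j)) : ℚ)).rank
      = A.rank := by
    rw [hM, Matrix.smul_mul, rank_smul_aux _ _ (inv_ne_zero hG),
      Matrix.rank_self_mul_transpose]
  have hrange : Set.range A.col = Set.range (cycCol (G := G) f) := by
    ext v
    constructor
    · rintro ⟨g, rfl⟩
      exact ⟨Quot.mk _ ⟨Subgroup.zpowers g, inferInstance⟩, rfl⟩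
    · rintro ⟨C, rfl⟩
      induction C using Quot.ind with
      | _ C =>
        obtain ⟨g, hg⟩ := (Subgroup.isCyclic_iff_exists_zpowers_eq_top C.1).mp C.2
        refine ⟨g, ?_⟩
        ext i
        change (markCount (f i) (Subgroup.zpowers g) : ℚ) / Nat.card (f i)
          = (markCount (f i) C.1 : ℚ) / Nat.card (f i)
        rw [hg]
  rw [hrank, Matrix.rank_eq_finrank_span_cols, hrange,
    finrank_span_eq_card (cycCol_linearIndependent f fun P => (hrep P).exists),
    Nat.card_eq_fintype_card]
end

section
/- Let G be a finite group. The square matrix over ℚ whose rows and columns are indexed by the conjugacy classes of subgroups of G, and whose (P,Q)-entry is the number |P\G/Q| of (P,Q)-double cosets in G, is nonsingular (invertible) if and only if G is cyclic. -/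
/-- The relation of double cosets corresponds to orbits of `P` on `G ⧸ Q`. -/
noncomputable def doubleCosetsEquivOrbits {G : Type*} [Group G] (P Q : Subgroup G) :
    DoubleCosets P Q ≃ MulAction.orbitRel.Quotient P (G ⧸ Q) := by
  refine Equiv.ofBijective
    (Quot.lift (fun x : G => (Quotient.mk (MulAction.orbitRel P (G ⧸ Q)) (x : G ⧸ Q))) ?_) ⟨?_, ?_⟩
  · rintro x y ⟨p, hp, q, hq, rfl⟩
    apply Quotient.sound
    refine ⟨⟨p⁻¹, P.inv_mem hp⟩, ?_⟩
    change ((p⁻¹ * (p * x * q⁻¹) : G) : G ⧸ Q) = x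
    rw [QuotientGroup.eq]
    simpa [mul_assoc] using hq
  · rintro ⟨x⟩ ⟨y⟩ h
    obtain ⟨⟨p, hp⟩, h⟩ := Quotient.exact h
    change ((p * y : G) : G ⧸ Q) = x at h
    rw [QuotientGroup.eq] at h
    refine Quot.sound ⟨p⁻¹, P.inv_mem hp, _, h, ?_⟩
    simp [mul_assoc]
  · intro z
    induction z using Quotient.inductionOn with
    | _ z =>
      induction z using QuotientGroup.induction_on with
      | _ x => exact ⟨Quot.mk _ x, rfl⟩

/-- The number of cosets in `G ⧸ Q` fixed by `P`. -/
noncomputable def markNum {G : Type*} [Group G] (P Q : Subgroup G) : ℕ :=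
  Nat.card {x : G ⧸ Q // ∀ p ∈ P, p • x = x}

theorem markNum_conj {G : Type*} [Group G] (P Q : Subgroup G) (g : G) :
    markNum (Subgroup.map (MulAut.conj g).toMonoidHom P) Q = markNum P Q := by
  unfold markNum
  refine Nat.card_congr (Equiv.subtypeEquiv (MulAction.toPerm g⁻¹) ?_)
  intro x
  constructor
  · intro h p hp
    have := h (g * p * g⁻¹) ⟨p, hp, by simp⟩
    simp only [MulAction.toPerm_apply]
    rw [mul_smul, mul_smul] at this
    rw [eq_inv_smul_iff, this]
  · rintro h _ ⟨p, hp, rfl⟩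
    have := h p hp
    simp only [MulAction.toPerm_apply] at this
    simp [mul_smul, this]

open scoped Classical in
theorem card_mul_doubleCosets {G : Type*} [Group G] [Fintype G] (P Q : Subgroup G) :
    Nat.card P * Nat.card (DoubleCosets P Q) =
      ∑ p : P, markNum (Subgroup.zpowers (p : G)) Q := by
  classical
  rw [Nat.card_congr (doubleCosetsEquivOrbits P Q)]
  haveI : Fintype (MulAction.orbitRel.Quotient P (G ⧸ Q)) := Fintype.ofFinite _
  have h := MulAction.sum_card_fixedBy_eq_card_orbits_mul_card_group P (G ⧸ Q)
  rw [Nat.card_eq_fintype_card, Nat.card_eq_fintype_card, mul_comm]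
  refine Eq.trans (Eq.trans ?_ h.symm) ?_
  · congr!
  · refine Finset.sum_congr rfl fun p _ => ?_
    rw [← Nat.card_eq_fintype_card]
    unfold markNum
    refine Nat.card_congr (Equiv.subtypeEquivRight ?_)
    intro x
    constructor
    · intro hx q hq
      have h1 : (p : G) ∈ MulAction.stabilizer G x := hx
      exact (Subgroup.zpowers_le.2 h1) hq
    · intro hx
      exact hx p (Subgroup.mem_zpowers _)

theorem det_ne_zero_of_graded {ι : Type} [Fintype ι] [DecidableEq ι] (M : Matrix ι ι ℚ)
    (b : ι → ℕ) (h : ∀ i j, M i j ≠ 0 → i = j ∨ b i < b j) (hd : ∀ i, M i i ≠ 0) :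
    M.det ≠ 0 := by
  have hM : M.BlockTriangular b := by
    intro i j hij
    by_contra hne
    rcases h i j hne with rfl | h' <;> omega
  rw [hM.det]
  refine Finset.prod_ne_zero_iff.2 fun a _ => ?_
  have : M.toSquareBlock b a = Matrix.diagonal fun i : {x // b x = a} => M i i := by
    ext i j
    by_cases hij : i = j
    · subst hij
      simp [Matrix.toSquareBlock_def]
    · rw [Matrix.diagonal_apply_ne _ hij]
      by_contra hne
      rcases h i j hne with h' | h'
      · exact hij (Subtype.ext h')
      · have h1 := i.2
        have h2 := j.2
        omega
  rw [this, Matrix.det_diagonal]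
  exact Finset.prod_ne_zero_iff.2 fun i _ => hd i

/-- **Th\'evenaz's curiosity.**  Let `G` be a finite group and let `f i`, for `i` in a
finite index type `ι`, be a system of representatives of the conjugacy classes of
subgroups of `G`.  Then the matrix `(|P\G/Q|)_{P,Q}` over `ℚ` is nonsingular if and
only if `G` is cyclic. -/
theorem doubleCoset_matrix_nonsingular_iff_isCyclic
    {G : Type*} [Group G] [Fintype G]
    {ι : Type} [Fintype ι] [DecidableEq ι] (f : ι → Subgroup G)
    (hrep : ∀ P : Subgroup G,
      ∃! i, ∃ g : G, Subgroup.map (MulAut.conj g).toMonoidHom P = f i) :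
    (Matrix.of fun i j : ι => (Nat.card (DoubleCosets (f i) (f j)) : ℚ)).det ≠ 0
      ↔ IsCyclic G := by
  classical
  choose c hc huniq using hrep
  have hcf : ∀ i, c (f i) = i := fun i =>
    (huniq (f i) i ⟨1, by ext; simp⟩).symm
  have hfinj : Function.Injective f := fun i j h => by rw [← hcf i, h, hcf]
  have hmark : ∀ P Q, markNum (f (c P)) Q = markNum P Q := by
    intro P Q
    obtain ⟨g, hg⟩ := hc P
    rw [← hg, markNum_conj]
  set A : Matrix ι ι ℚ := Matrix.of fun i k =>
    (Nat.card (f i) : ℚ)⁻¹ * ∑ p : f i, if c (Subgroup.zpowers (p : G)) = k then 1 else 0 with hA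
  set B : Matrix ι ι ℚ := Matrix.of fun k j => (markNum (f k) (f j) : ℚ) with hB
  have hpos : ∀ i, (Nat.card (f i) : ℚ) ≠ 0 := fun i => by
    exact_mod_cast Nat.card_pos.ne'
  have hM : (Matrix.of fun i j : ι => (Nat.card (DoubleCosets (f i) (f j)) : ℚ)) = A * B := by
    ext i j
    rw [Matrix.mul_apply]
    have h := card_mul_doubleCosets (f i) (f j)
    have h' : (Nat.card (f i) : ℚ) * Nat.card (DoubleCosets (f i) (f j)) =
      ∑ p : f i, (markNum (Subgroup.zpowers (p : G)) (f j) : ℚ) := by exact_mod_cast h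
    simp only [hA, hB, Matrix.of_apply, mul_assoc]
    rw [← Finset.mul_sum, eq_inv_mul_iff_mul_eq₀ (hpos i), h']
    simp only [Finset.sum_mul]
    rw [Finset.sum_comm]
    refine Finset.sum_congr rfl fun p _ => ?_
    simp [hmark]
  have hAne : ∀ i k, A i k ≠ 0 → ∃ p : f i, c (Subgroup.zpowers (p : G)) = k := by
    intro i k h
    by_contra! hno
    apply h
    simp [hA, hno]
  rw [hM, Matrix.det_mul]
  constructor
  · intro hdet
    by_contra hcyc
    apply hdet
    rw [Matrix.det_eq_zero_of_column_eq_zero (c ⊤), zero_mul]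
    intro i
    by_contra hne
    obtain ⟨p, hp⟩ := hAne _ _ hne
    obtain ⟨g, hg⟩ := hc (Subgroup.zpowers (p : G))
    obtain ⟨g', hg'⟩ := hc ⊤
    rw [hp, ← hg', Subgroup.map_top_of_surjective _ (MulAut.conj g').surjective,
      MonoidHom.map_zpowers] at hg
    exact hcyc ⟨(MulAut.conj g).toMonoidHom (p : G), fun x => by
      have hx : x ∈ (⊤ : Subgroup G) := trivial
      rw [← hg] at hx
      exact hx⟩
  · intro hcyc
    letI : CommGroup G := IsCyclic.commGroup
    have hcc : ∀ P, f (c P) = P := by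
      intro P
      obtain ⟨g, hg⟩ := hc P
      rw [← hg]
      ext x
      simp [Subgroup.mem_map]
    have key : ∀ i j, f i ≤ f j → i = j ∨ Nat.card (f i) < Nat.card (f j) := by
      intro i j hij
      rcases (Subgroup.card_le_of_le hij).lt_or_eq with h | h
      · exact Or.inr h
      · exact Or.inl (hfinj (Subgroup.eq_of_le_of_card_ge hij h.ge))
    refine mul_ne_zero ?_ ?_
    · rw [← Matrix.det_transpose]
      refine det_ne_zero_of_graded _ (fun i => Nat.card (f i)) ?_ ?_
      · intro k i h
        obtain ⟨p, hp⟩ := hAne i k h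
        apply key
        rw [← hp, hcc, Subgroup.zpowers_le]
        exact p.2
      · intro i
        obtain ⟨p, hp⟩ := (Subgroup.isCyclic_iff_exists_zpowers_eq_top (f i)).1 inferInstance
        have hpm : p ∈ f i := hp ▸ Subgroup.mem_zpowers p
        simp only [Matrix.transpose_apply, hA, Matrix.of_apply]
        refine mul_ne_zero (inv_ne_zero (hpos i)) (ne_of_gt ?_)
        refine Finset.sum_pos' (fun _ _ => by split_ifs <;> norm_num)
          ⟨⟨p, hpm⟩, Finset.mem_univ _, ?_⟩
        simp [hp, hcf]
    · refine det_ne_zero_of_graded _ (fun i => Nat.card (f i)) ?_ ?_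
      · intro k j h
        apply key
        simp only [hB, Matrix.of_apply, markNum, Nat.cast_ne_zero] at h
        obtain ⟨⟨x, hx⟩⟩ := (Nat.card_ne_zero.1 h).1
        intro p hp
        induction x using QuotientGroup.induction_on with
        | _ x =>
          have := hx p hp
          change ((p * x : G) : G ⧸ f j) = x at this
          rw [QuotientGroup.eq] at this
          have h2 := (f j).inv_mem this
          have h3 : ((p * x)⁻¹ * x)⁻¹ = p := by
            rw [mul_inv_rev, inv_inv, mul_comm p x, inv_mul_cancel_left]
          rwa [h3] at h2
      · intro i
        simp only [hB, Matrix.of_apply, markNum, Nat.cast_ne_zero]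
        refine Nat.card_ne_zero.2 ⟨⟨((1 : G) : G ⧸ f i), ?_⟩, inferInstance⟩
        intro p hp
        change ((p * 1 : G) : G ⧸ f i) = (1 : G)
        rw [QuotientGroup.eq]
        simpa using hp
end
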